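/- Let m be a positive integer, μ, λ₁, …, λ_n ∈ ℂ with all λ_i ≠ μ, and x₁,…,x_n, y with the x_i pairwise distinct and distinct from y. Define K(x,y;z) = A(z,x)^m A(z,y) / (A(x)^m A(x,y) A(z)^m) · e^{μ(x̄ − z̄ + y/m)}, where z = (z₁,…,z_n), A(z,x) = ∏_{i,j}(z_i − x_j), A(z,y) = ∏_i(z_i − y), A(x,y) = ∏_i(x_i − y). Then L_m^{(n,1)}(x,y) K = L_m^{(n)}(z) K + μ²(n − n − 1/m)K = L_m^{(n)}(z)K − (μ²/m)K, where L_m^{(n,1)} = −∑_{i=1}^n ∂²/∂x_i² − m∂²/∂y² + ∑_{i<j} 2m(m+1)/(x_i−x_j)² + ∑_i 2(m+1)/(x_i−y)² is the deformed rational Calogero–Moser operator and L_m^{(n)}(z) the ordinary n-particle one. -/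

import Mathlib

open Complex Finset

/-- The kernel function `K(x, y; z)` of the deformed rational Calogero–Moser operator. -/
noncomputable def calogeroKernel (m n : ℕ) (μ : ℂ) (X : Fin n → ℂ) (Y : ℂ) (Z : Fin n → ℂ) : ℂ :=
  (∏ i, ∏ j, (Z i - X j)) ^ m * (∏ i, (Z i - Y))
    / ((∏ i, ∏ j ∈ Finset.Ioi i, (X i - X j)) ^ m * (∏ i, (X i - Y))
        * (∏ i, ∏ j ∈ Finset.Ioi i, (Z i - Z j)) ^ m)
    * Complex.exp (μ * (∑ i, X i - ∑ i, Z i + Y / (m : ℂ)))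

/-- `g` has logarithmic derivative `u` at `s`, in a form that allows `g s = 0`. -/
def HasLogDerivAt (g : ℂ → ℂ) (u s : ℂ) : Prop := HasDerivAt g (g s * u) s

namespace HasLogDerivAt

variable {g h : ℂ → ℂ} {u v s : ℂ}

theorem const (c s : ℂ) : HasLogDerivAt (fun _ => c) 0 s := by
  simpa [HasLogDerivAt] using hasDerivAt_const s c

theorem of_hasDerivAt (hg : HasDerivAt g u s) (h0 : g s ≠ 0) : HasLogDerivAt g (u / g s) s := by
  unfold HasLogDerivAt
  rwa [mul_div_cancel₀ _ h0]

theorem mul (hg : HasLogDerivAt g u s) (hh : HasLogDerivAt h v s) :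
    HasLogDerivAt (fun t => g t * h t) (u + v) s := by
  refine (HasDerivAt.fun_mul hg hh).congr_deriv ?_
  ring

theorem div (hg : HasLogDerivAt g u s) (hh : HasLogDerivAt h v s) (h0 : h s ≠ 0) :
    HasLogDerivAt (fun t => g t / h t) (u - v) s := by
  refine (HasDerivAt.fun_div hg hh h0).congr_deriv ?_
  field_simp

theorem pow (hg : HasLogDerivAt g u s) (m : ℕ) :
    HasLogDerivAt (fun t => g t ^ m) (m * u) s := by
  induction m with
  | zero => simpa using const 1 s
  | succ k ih =>
    simpa only [pow_succ, Nat.cast_succ, add_mul, one_mul] using ih.mul hg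

theorem exp (hg : HasDerivAt g u s) : HasLogDerivAt (fun t => Complex.exp (g t)) u s :=
  hg.cexp

theorem prod {ι : Type*} (S : Finset ι) {G : ι → ℂ → ℂ} {U : ι → ℂ}
    (hG : ∀ i ∈ S, HasLogDerivAt (G i) (U i) s) :
    HasLogDerivAt (fun t => ∏ i ∈ S, G i t) (∑ i ∈ S, U i) s := by
  classical
  induction S using Finset.induction_on with
  | empty => simpa using const 1 s
  | insert a S ha ih =>
    simp only [Finset.prod_insert ha, Finset.sum_insert ha]
    exact (hG a (by simp)).mul (ih fun i hi => hG i (by simp [hi]))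

end HasLogDerivAt

theorem hasLogDerivAt_sub_const {s c : ℂ} (h : s ≠ c) :
    HasLogDerivAt (fun t => t - c) (s - c)⁻¹ s := by
  simpa using HasLogDerivAt.of_hasDerivAt ((hasDerivAt_id s).sub_const c) (sub_ne_zero.2 h)

theorem hasLogDerivAt_const_sub {s c : ℂ} (h : s ≠ c) :
    HasLogDerivAt (fun t => c - t) (s - c)⁻¹ s := by
  have h1 := HasLogDerivAt.of_hasDerivAt ((hasDerivAt_id' s).const_sub c) (sub_ne_zero.2 h.symm)
  rwa [neg_div, ← div_neg, neg_sub, one_div] at h1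

theorem deriv_deriv_of_hasLogDerivAt {ι : Type*} (S : Finset ι) (p c : ι → ℂ) (α : ℂ) (g : ℂ → ℂ)
    (hg : ∀ s, (∀ i ∈ S, s ≠ p i) → HasLogDerivAt g (α + ∑ i ∈ S, c i * (s - p i)⁻¹) s)
    (s : ℂ) (hs : ∀ i ∈ S, s ≠ p i) :
    deriv (deriv g) s = g s * ((α + ∑ i ∈ S, c i * (s - p i)⁻¹) ^ 2
      - ∑ i ∈ S, c i * ((s - p i)⁻¹) ^ 2) := by
  have hev : ∀ᶠ t in nhds s, ∀ i ∈ S, t ≠ p i := by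
    rw [Filter.eventually_all_finset]
    exact fun i hi => eventually_ne_nhds (hs i hi)
  have hd : deriv g =ᶠ[nhds s] fun t => g t * (α + ∑ i ∈ S, c i * (t - p i)⁻¹) :=
    hev.mono fun t ht => HasDerivAt.deriv (hg t ht)
  rw [hd.deriv_eq]
  have hu : HasDerivAt (fun t => α + ∑ i ∈ S, c i * (t - p i)⁻¹)
      (∑ i ∈ S, c i * (-1 / (s - p i) ^ 2)) s := by
    refine (HasDerivAt.fun_sum fun i hi => ?_).const_add α
    exact (((hasDerivAt_id s).sub_const (p i)).fun_inv (sub_ne_zero.2 (hs i hi))).const_mul (c i)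
  refine ((HasDerivAt.fun_mul (hg s hs) hu).deriv).trans ?_
  have : ∑ i ∈ S, c i * (-1 / (s - p i) ^ 2) = - ∑ i ∈ S, c i * ((s - p i)⁻¹) ^ 2 := by
    rw [← Finset.sum_neg_distrib]
    exact Finset.sum_congr rfl fun i _ => by rw [inv_pow]; ring
  rw [this]
  ring

theorem inv_sub_cyclic_sum {ι : Type*} [DecidableEq ι] {p : ι → ℂ}
    (hp : Function.Injective p) (a b c : ι) :
    (p a - p b)⁻¹ * (p a - p c)⁻¹ + (p b - p c)⁻¹ * (p b - p a)⁻¹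
      + (p c - p a)⁻¹ * (p c - p b)⁻¹
    = (if b = c then ((p a - p b)⁻¹) ^ 2 else 0) + (if c = a then ((p b - p c)⁻¹) ^ 2 else 0)
      + (if a = b then ((p c - p a)⁻¹) ^ 2 else 0) := by
  by_cases hab : a = b
  · subst hab
    by_cases hac : a = c
    · subst hac; simp
    · simp [hac, Ne.symm hac, sq]
  by_cases hbc : b = c
  · subst hbc
    simp [hab, Ne.symm hab, sq]
  by_cases hca : c = a
  · subst hca
    simp [hab, hbc, sq]
  simp only [hab, hbc, hca, if_false]
  have h1 := sub_ne_zero.2 (hp.ne hab)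
  have h2 := sub_ne_zero.2 (hp.ne hbc)
  have h3 := sub_ne_zero.2 (hp.ne hca)
  rw [← neg_sub (p c) (p a), ← neg_sub (p a) (p b), ← neg_sub (p b) (p c)]
  simp only [inv_neg]
  field_simp
  ring

theorem sum_mul_sq_sum_inv_sub {ι : Type*} [Fintype ι] {p : ι → ℂ}
    (hp : Function.Injective p) (q : ι → ℂ) :
    ∑ a, q a * (∑ b, q b * (p a - p b)⁻¹) ^ 2
      = ∑ a, ∑ b, q a * q b ^ 2 * ((p a - p b)⁻¹) ^ 2 := by
  classical
  let f : ι → ι → ι → ℂ := fun a b c => q a * q b * q c * ((p a - p b)⁻¹ * (p a - p c)⁻¹)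
  let e : ι → ι → ι → ℂ := fun a b c =>
    q a * q b * q c * (if b = c then ((p a - p b)⁻¹) ^ 2 else 0)
  have hrot (F : ι → ι → ι → ℂ) : ∑ a, ∑ b, ∑ c, F b c a = ∑ a, ∑ b, ∑ c, F a b c := by
    rw [Finset.sum_comm]
    exact Finset.sum_congr rfl fun b _ => Finset.sum_comm
  have hL : ∑ a, q a * (∑ b, q b * (p a - p b)⁻¹) ^ 2 = ∑ a, ∑ b, ∑ c, f a b c := by
    refine Finset.sum_congr rfl fun a _ => ?_
    rw [sq, Finset.sum_mul_sum, Finset.mul_sum]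
    refine Finset.sum_congr rfl fun b _ => ?_
    rw [Finset.mul_sum]
    exact Finset.sum_congr rfl fun c _ => by simp only [f]; ring
  have hR : ∑ a, ∑ b, q a * q b ^ 2 * ((p a - p b)⁻¹) ^ 2 = ∑ a, ∑ b, ∑ c, e a b c := by
    refine Finset.sum_congr rfl fun a _ => Finset.sum_congr rfl fun b _ => ?_
    simp only [e, mul_ite, mul_zero, Finset.sum_ite_eq, Finset.mem_univ, if_true]
    ring
  have key : ∑ a, ∑ b, ∑ c, (f a b c + f b c a + f c a b)
      = ∑ a, ∑ b, ∑ c, (e a b c + e b c a + e c a b) := by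
    refine Finset.sum_congr rfl fun a _ => Finset.sum_congr rfl fun b _ =>
      Finset.sum_congr rfl fun c _ => ?_
    linear_combination (q a * q b * q c) * inv_sub_cyclic_sum hp a b c
  simp only [Finset.sum_add_distrib] at key
  rw [hrot f, hrot e, ← hrot fun a b c => f c a b, ← hrot fun a b c => e c a b] at key
  rw [hL, hR]
  linear_combination key / 3

theorem sum_mul_sq_add_sum_inv_sub {ι : Type*} [Fintype ι] {p : ι → ℂ}
    (hp : Function.Injective p) (q : ι → ℂ) (κ μ : ℂ) :
    ∑ a, (q a * (μ + κ * ∑ b, q b * (p a - p b)⁻¹) ^ 2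
        - κ * ∑ b, q b * ((p a - p b)⁻¹) ^ 2)
      = μ ^ 2 * ∑ a, q a
        + κ / 2 * ∑ a, ∑ b, (q a + q b) * (κ * q a * q b - 1) * ((p a - p b)⁻¹) ^ 2 := by
  have hcross : ∑ a, q a * ∑ b, q b * (p a - p b)⁻¹ = 0 := by
    simp only [Finset.mul_sum]
    refine self_eq_neg.1 ?_
    conv_lhs => rw [Finset.sum_comm]
    simp only [← Finset.sum_neg_distrib]
    refine Finset.sum_congr rfl fun a _ => Finset.sum_congr rfl fun b _ => ?_
    rw [← neg_sub (p a) (p b), inv_neg]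
    ring
  have hsymm (F : ι → ι → ℂ) : ∑ a, ∑ b, F b a * ((p a - p b)⁻¹) ^ 2
      = ∑ a, ∑ b, F a b * ((p a - p b)⁻¹) ^ 2 := by
    rw [Finset.sum_comm]
    refine Finset.sum_congr rfl fun a _ => Finset.sum_congr rfl fun b _ => ?_
    rw [← neg_sub (p a) (p b), inv_neg, neg_sq]
  have h1 := hsymm fun a b => q b
  have h2 := hsymm fun a b => q a * q b ^ 2
  have hE : ∑ a, ∑ b, (q a + q b) * (κ * q a * q b - 1) * ((p a - p b)⁻¹) ^ 2
      = κ * (∑ a, ∑ b, q a * q b ^ 2 * ((p a - p b)⁻¹) ^ 2)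
        + κ * (∑ a, ∑ b, q b * q a ^ 2 * ((p a - p b)⁻¹) ^ 2)
        - (∑ a, ∑ b, q a * ((p a - p b)⁻¹) ^ 2) - ∑ a, ∑ b, q b * ((p a - p b)⁻¹) ^ 2 := by
    simp only [Finset.mul_sum, ← Finset.sum_add_distrib, ← Finset.sum_sub_distrib]
    exact Finset.sum_congr rfl fun a _ => Finset.sum_congr rfl fun b _ => by ring
  have hS : ∑ a, (q a * (μ + κ * ∑ b, q b * (p a - p b)⁻¹) ^ 2
        - κ * ∑ b, q b * ((p a - p b)⁻¹) ^ 2)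
      = μ ^ 2 * (∑ a, q a) + 2 * μ * κ * (∑ a, q a * ∑ b, q b * (p a - p b)⁻¹)
        + κ ^ 2 * (∑ a, q a * (∑ b, q b * (p a - p b)⁻¹) ^ 2)
        - κ * ∑ a, ∑ b, q b * ((p a - p b)⁻¹) ^ 2 := by
    rw [Finset.mul_sum, Finset.mul_sum, Finset.mul_sum, Finset.mul_sum]
    simp only [← Finset.sum_add_distrib, ← Finset.sum_sub_distrib]
    exact Finset.sum_congr rfl fun a _ => by ring
  rw [hS, hE, hcross, sum_mul_sq_sum_inv_sub hp]
  linear_combination (κ / 2) * h1 - κ ^ 2 / 2 * h2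

theorem hasLogDerivAt_vandermonde_update {n : ℕ} (x : Fin n → ℂ) (k : Fin n) {s : ℂ}
    (hs : ∀ j, j ≠ k → s ≠ x j) :
    HasLogDerivAt
      (fun t => ∏ i, ∏ j ∈ Finset.Ioi i, (Function.update x k t i - Function.update x k t j))
      (∑ j, if j = k then 0 else (s - x j)⁻¹) s := by
  let F : Fin n → Fin n → ℂ := fun j i => if i = k ∧ j ≠ k then (s - x j)⁻¹ else 0
  have hF : ∑ j, (if j = k then 0 else (s - x j)⁻¹)
      = ∑ i, ∑ j ∈ Finset.Ioi i, (F j i + F i j) := by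
    have hk : ∑ i, ∑ j ∈ {i}ᶜ, F j i = ∑ j ∈ {k}ᶜ, F j k :=
      Finset.sum_eq_single k (fun i _ hi => by simp [F, hi]) (by simp)
    have hsub : ∑ j ∈ {k}ᶜ, F j k = ∑ j, F j k :=
      Finset.sum_subset (Finset.subset_univ _) fun j _ hj => by
        have : j = k := by simpa using hj
        simp [F, this]
    rw [Finset.sum_sum_Ioi_add_eq_sum_sum_off_diag, hk, hsub]
    exact Finset.sum_congr rfl fun j _ => by by_cases hj : j = k <;> simp [F, hj]
  rw [hF]
  refine HasLogDerivAt.prod _ fun i _ => HasLogDerivAt.prod _ fun j hj => ?_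
  have hij : i ≠ j := (Finset.mem_Ioi.1 hj).ne
  by_cases hi : i = k
  · subst hi
    simpa [F, hij.symm, hij] using hasLogDerivAt_sub_const (hs j hij.symm)
  by_cases hjk : j = k
  · subst hjk
    simpa [F, hij] using hasLogDerivAt_const_sub (hs i hij)
  simpa [F, hi, hjk] using HasLogDerivAt.const (x i - x j) s

theorem hasLogDerivAt_prod_sub_update {n : ℕ} (x z : Fin n → ℂ) (k : Fin n) {s : ℂ}
    (hs : ∀ i, s ≠ z i) :
    HasLogDerivAt (fun t => ∏ i, ∏ j, (z i - Function.update x k t j))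
      (∑ i, (s - z i)⁻¹) s := by
  refine HasLogDerivAt.prod _ fun i _ => ?_
  have h : (s - z i)⁻¹ = ∑ j, if j = k then (s - z i)⁻¹ else 0 := by simp
  rw [h]
  refine HasLogDerivAt.prod _ fun j _ => ?_
  by_cases hj : j = k
  · subst hj
    simpa using hasLogDerivAt_const_sub (hs i)
  · simpa [hj] using HasLogDerivAt.const (z i - x j) s

theorem hasLogDerivAt_prod_update_sub {n : ℕ} (z x : Fin n → ℂ) (k : Fin n) {s : ℂ}
    (hs : ∀ j, s ≠ x j) :
    HasLogDerivAt (fun t => ∏ i, ∏ j, (Function.update z k t i - x j))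
      (∑ j, (s - x j)⁻¹) s := by
  have h : ∑ j, (s - x j)⁻¹ = ∑ i, ∑ j, if i = k then (s - x j)⁻¹ else 0 := by
    rw [Finset.sum_comm]
    simp
  rw [h]
  refine HasLogDerivAt.prod _ fun i _ => HasLogDerivAt.prod _ fun j _ => ?_
  by_cases hi : i = k
  · subst hi
    simpa using hasLogDerivAt_sub_const (hs j)
  · simpa [hi] using HasLogDerivAt.const (z i - x j) s

theorem hasLogDerivAt_prod_update_sub_const {n : ℕ} (z : Fin n → ℂ) (y : ℂ) (k : Fin n) {s : ℂ}
    (hs : s ≠ y) :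
    HasLogDerivAt (fun t => ∏ i, (Function.update z k t i - y)) (s - y)⁻¹ s := by
  have h : (s - y)⁻¹ = ∑ i, if i = k then (s - y)⁻¹ else 0 := by simp
  rw [h]
  refine HasLogDerivAt.prod _ fun i _ => ?_
  by_cases hi : i = k
  · subst hi
    simpa using hasLogDerivAt_sub_const hs
  · simpa [hi] using HasLogDerivAt.const (z i - y) s

theorem hasDerivAt_sum_update {n : ℕ} (x : Fin n → ℂ) (k : Fin n) (s : ℂ) :
    HasDerivAt (fun t => ∑ i, Function.update x k t i) 1 s := by
  simp only [Finset.sum_update_of_mem (Finset.mem_univ k)]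
  exact (hasDerivAt_id' s).add_const _

theorem prod_prod_Ioi_sub_ne_zero {n : ℕ} {x : Fin n → ℂ} (hx : ∀ i j, i ≠ j → x i ≠ x j) :
    ∏ i, ∏ j ∈ Finset.Ioi i, (x i - x j) ≠ 0 :=
  Finset.prod_ne_zero_iff.2 fun i _ => Finset.prod_ne_zero_iff.2 fun _ hj =>
    sub_ne_zero.2 (hx i _ (Finset.mem_Ioi.1 hj).ne)

theorem prod_sub_const_ne_zero {n : ℕ} {x : Fin n → ℂ} {y : ℂ} (hxy : ∀ i, x i ≠ y) :
    ∏ i, (x i - y) ≠ 0 :=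
  Finset.prod_ne_zero_iff.2 fun i _ => sub_ne_zero.2 (hxy i)

theorem update_pairwise_ne {n : ℕ} {x : Fin n → ℂ} (hx : ∀ i j, i ≠ j → x i ≠ x j) {k : Fin n}
    {s : ℂ} (hs : ∀ j, j ≠ k → s ≠ x j) (i j : Fin n) (hij : i ≠ j) :
    Function.update x k s i ≠ Function.update x k s j := by
  by_cases hi : i = k
  · subst hi
    simpa [hij.symm] using hs j hij.symm
  by_cases hj : j = k
  · subst hj
    simpa [hij] using (hs i hij).symm
  simpa [hi, hj] using hx i j hij

theorem update_ne_const {n : ℕ} {x : Fin n → ℂ} {y : ℂ} (hxy : ∀ i, x i ≠ y) (k : Fin n)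
    {s : ℂ} (hs : s ≠ y) (i : Fin n) : Function.update x k s i ≠ y := by
  by_cases hi : i = k
  · subst hi
    simpa using hs
  · simpa [hi] using hxy i

section Kernel

variable {m n : ℕ} {μ y : ℂ} {x z : Fin n → ℂ}

theorem hasLogDerivAt_calogeroKernel_fst (hx : ∀ i j, i ≠ j → x i ≠ x j) (hxy : ∀ i, x i ≠ y)
    (hz : ∀ i j, i ≠ j → z i ≠ z j) (k : Fin n) {s : ℂ} (hs : ∀ j, j ≠ k → s ≠ x j)
    (hsy : s ≠ y) (hsz : ∀ i, s ≠ z i) :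
    HasLogDerivAt (fun t => calogeroKernel m n μ (Function.update x k t) y z)
      (m * ∑ i, (s - z i)⁻¹ + 0
        - (m * (∑ j, if j = k then 0 else (s - x j)⁻¹) + (s - y)⁻¹ + 0) + μ) s := by
  refine HasLogDerivAt.mul (HasLogDerivAt.div (HasLogDerivAt.mul
    ((hasLogDerivAt_prod_sub_update x z k hsz).pow m) (HasLogDerivAt.const _ s))
    (HasLogDerivAt.mul (HasLogDerivAt.mul ((hasLogDerivAt_vandermonde_update x k hs).pow m)
    (hasLogDerivAt_prod_update_sub_const x y k hsy)) (HasLogDerivAt.const _ s)) ?_)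
    (HasLogDerivAt.exp ?_)
  · exact mul_ne_zero (mul_ne_zero
      (pow_ne_zero m (prod_prod_Ioi_sub_ne_zero (update_pairwise_ne hx hs)))
      (prod_sub_const_ne_zero (update_ne_const hxy k hsy)))
      (pow_ne_zero m (prod_prod_Ioi_sub_ne_zero hz))
  · simpa using (((hasDerivAt_sum_update x k s).sub_const (∑ i, z i)).add_const
      (y / (m : ℂ))).const_mul μ

theorem hasLogDerivAt_calogeroKernel_snd (hx : ∀ i j, i ≠ j → x i ≠ x j)
    (hz : ∀ i j, i ≠ j → z i ≠ z j) {s : ℂ} (hsx : ∀ i, s ≠ x i) (hsz : ∀ i, s ≠ z i) :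
    HasLogDerivAt (fun t => calogeroKernel m n μ x t z)
      (0 + ∑ i, (s - z i)⁻¹ - (0 + ∑ i, (s - x i)⁻¹ + 0) + μ / m) s := by
  refine HasLogDerivAt.mul (HasLogDerivAt.div (HasLogDerivAt.mul
    (HasLogDerivAt.const _ s) (HasLogDerivAt.prod _ fun i _ => hasLogDerivAt_const_sub (hsz i)))
    (HasLogDerivAt.mul (HasLogDerivAt.mul (HasLogDerivAt.const _ s)
    (HasLogDerivAt.prod _ fun i _ => hasLogDerivAt_const_sub (hsx i)))
    (HasLogDerivAt.const _ s)) ?_) (HasLogDerivAt.exp ?_)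
  · exact mul_ne_zero (mul_ne_zero (pow_ne_zero m (prod_prod_Ioi_sub_ne_zero hx))
      (prod_sub_const_ne_zero fun i => (hsx i).symm))
      (pow_ne_zero m (prod_prod_Ioi_sub_ne_zero hz))
  · simpa [div_eq_mul_inv] using (((hasDerivAt_id s).div_const (m : ℂ)).const_add
      (∑ i, x i - ∑ i, z i)).const_mul μ

theorem hasLogDerivAt_calogeroKernel_thd (hx : ∀ i j, i ≠ j → x i ≠ x j) (hxy : ∀ i, x i ≠ y)
    (hz : ∀ i j, i ≠ j → z i ≠ z j) (k : Fin n) {s : ℂ} (hs : ∀ j, j ≠ k → s ≠ z j)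
    (hsy : s ≠ y) (hsx : ∀ i, s ≠ x i) :
    HasLogDerivAt (fun t => calogeroKernel m n μ x y (Function.update z k t))
      (m * ∑ i, (s - x i)⁻¹ + (s - y)⁻¹
        - (0 + m * (∑ j, if j = k then 0 else (s - z j)⁻¹)) + -μ) s := by
  refine HasLogDerivAt.mul (HasLogDerivAt.div (HasLogDerivAt.mul
    ((hasLogDerivAt_prod_update_sub z x k hsx).pow m)
    (hasLogDerivAt_prod_update_sub_const z y k hsy))
    (HasLogDerivAt.mul (HasLogDerivAt.const _ s)
    ((hasLogDerivAt_vandermonde_update z k hs).pow m)) ?_) (HasLogDerivAt.exp ?_)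
  · exact mul_ne_zero (mul_ne_zero (pow_ne_zero m (prod_prod_Ioi_sub_ne_zero hx))
      (prod_sub_const_ne_zero hxy))
      (pow_ne_zero m (prod_prod_Ioi_sub_ne_zero (update_pairwise_ne hz hs)))
  · simpa using (((hasDerivAt_sum_update z k s).const_sub (∑ i, x i)).add_const
      (y / (m : ℂ))).const_mul μ

end Kernel

theorem deriv_deriv_of_charges {ι : Type*} [Fintype ι] [DecidableEq ι] {P : ι → ℂ}
    (hP : Function.Injective P) (q : ι → ℂ) (κ μ : ℂ) (a : ι) (g : ℂ → ℂ)
    (hg : ∀ s, (∀ b, b ≠ a → s ≠ P b) →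
      HasLogDerivAt g (μ * q a + ∑ b, if b = a then 0 else κ * q a * q b * (s - P b)⁻¹) s) :
    deriv (deriv g) (P a) = q a * (g (P a) * (q a * (μ + κ * ∑ b, q b * (P a - P b)⁻¹) ^ 2
        - κ * ∑ b, q b * ((P a - P b)⁻¹) ^ 2)) := by
  have herase (F : ι → ℂ) :
      ∑ b ∈ Finset.univ.erase a, F b = ∑ b, if b = a then 0 else F b := by
    rw [← Finset.sum_erase Finset.univ (a := a) (by simp)]
    exact Finset.sum_congr rfl fun b hb => by rw [if_neg (Finset.ne_of_mem_erase hb)]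
  rw [deriv_deriv_of_hasLogDerivAt (Finset.univ.erase a) P (fun b => κ * q a * q b) (μ * q a) g
    (fun s hs => ?_) (P a) fun b hb => hP.ne (Finset.ne_of_mem_erase hb).symm]
  · rw [Finset.sum_erase _ (by simp), Finset.sum_erase _ (by simp)]
    simp only [mul_assoc, ← Finset.mul_sum]
    ring
  · rw [herase]
    exact hg s fun b hb => hs b (by simp [hb])

theorem sum_sum_Ioi_div_sq {n : ℕ} (x : Fin n → ℂ) (c : ℂ) :
    ∑ i, ∑ j ∈ Finset.Ioi i, 2 * c / (x i - x j) ^ 2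
      = c * ∑ i, ∑ j, ((x i - x j)⁻¹) ^ 2 := by
  have h : ∀ i, ∑ j, ((x i - x j)⁻¹) ^ 2 = ∑ j ∈ {i}ᶜ, ((x j - x i)⁻¹) ^ 2 := fun i => by
    rw [← Finset.sum_subset (Finset.subset_univ ({i}ᶜ : Finset (Fin n)))]
    · exact Finset.sum_congr rfl fun j _ => by rw [← neg_sub (x j), inv_neg, neg_sq]
    · intro j _ hj
      have : j = i := by simpa using hj
      simp [this]
  simp only [h]
  rw [← Finset.sum_sum_Ioi_add_eq_sum_sum_off_diag fun j i => ((x j - x i)⁻¹) ^ 2, Finset.mul_sum]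
  refine Finset.sum_congr rfl fun i _ => ?_
  rw [Finset.mul_sum]
  refine Finset.sum_congr rfl fun j _ => ?_
  rw [← neg_sub (x i) (x j), inv_neg, neg_sq, inv_pow]
  ring

/-- The deformed rational Calogero–Moser operator `L_m^{(n,1)}` applied to `f`. -/
noncomputable def deformedCalogeroMoser (m : ℕ) {n : ℕ} (f : (Fin n → ℂ) → ℂ → ℂ)
    (x : Fin n → ℂ) (y : ℂ) : ℂ :=
  -(∑ i, deriv (deriv (fun s => f (Function.update x i s) y)) (x i))
    - (m : ℂ) * deriv (deriv (fun s => f x s)) y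
    + ((∑ i, ∑ j ∈ Finset.Ioi i, 2 * (m : ℂ) * ((m : ℂ) + 1) / (x i - x j) ^ 2)
        + (∑ i, 2 * ((m : ℂ) + 1) / (x i - y) ^ 2)) * f x y

/-- The rational Calogero–Moser operator `L_m^{(n)}` applied to `f`. -/
noncomputable def calogeroMoser (m : ℕ) {n : ℕ} (f : (Fin n → ℂ) → ℂ) (z : Fin n → ℂ) : ℂ :=
  -(∑ i, deriv (deriv (fun s => f (Function.update z i s))) (z i))
    + (∑ i, ∑ j ∈ Finset.Ioi i, 2 * (m : ℂ) * ((m : ℂ) + 1) / (z i - z j) ^ 2) * f z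

section KernelIdentity

variable {m n : ℕ} {μ y : ℂ} {x z : Fin n → ℂ}

theorem deformedCalogeroMoser_calogeroKernel_of_generic (hm : 0 < m)
    (hx : ∀ i j, i ≠ j → x i ≠ x j) (hxy : ∀ i, x i ≠ y) (hz : ∀ i j, i ≠ j → z i ≠ z j)
    (hzx : ∀ i j, z i ≠ x j) (hzy : ∀ i, z i ≠ y) :
    deformedCalogeroMoser m (fun X Y => calogeroKernel m n μ X Y z) x y
      = calogeroMoser m (fun Z => calogeroKernel m n μ x y Z) z
        - μ ^ 2 / (m : ℂ) * calogeroKernel m n μ x y z := by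
  have hm0 : (m : ℂ) ≠ 0 := by exact_mod_cast hm.ne'
  let P : (Fin n ⊕ Unit) ⊕ Fin n → ℂ := Sum.elim (Sum.elim x fun _ => y) z
  let q : (Fin n ⊕ Unit) ⊕ Fin n → ℂ :=
    Sum.elim (Sum.elim (fun _ => 1) fun _ => (m : ℂ)⁻¹) fun _ => -1
  have hinj {w : Fin n → ℂ} (hw : ∀ i j, i ≠ j → w i ≠ w j) : Function.Injective w :=
    fun i j h => by_contra fun hij => hw i j hij h
  have hP : Function.Injective P := by
    refine Function.Injective.sumElim (Function.Injective.sumElim (hinj hx)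
      (Function.injective_of_subsingleton _) fun i _ => hxy i) (hinj hz) ?_
    rintro (i | _) j
    · exact (hzx j i).symm
    · exact (hzy j).symm
  let T : (Fin n ⊕ Unit) ⊕ Fin n → ℂ := fun a =>
    q a * (μ + -(m : ℂ) * ∑ b, q b * (P a - P b)⁻¹) ^ 2
      - -(m : ℂ) * ∑ b, q b * ((P a - P b)⁻¹) ^ 2
  have hite (k : Fin n) (F : Fin n → ℂ) :
      ∑ j, (if j = k then 0 else -(m * F j)) = -(m * ∑ j, if j = k then 0 else F j) := by
    rw [Finset.mul_sum, ← Finset.sum_neg_distrib]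
    exact Finset.sum_congr rfl fun j _ => by by_cases hj : j = k <;> simp [hj]
  have hdx (k : Fin n) :
      deriv (deriv fun s => calogeroKernel m n μ (Function.update x k s) y z) (x k)
        = calogeroKernel m n μ x y z * T (.inl (.inl k)) := by
    refine (deriv_deriv_of_charges hP q (-(m : ℂ)) μ (.inl (.inl k)) _ fun s hs => ?_).trans ?_
    · convert hasLogDerivAt_calogeroKernel_fst hx hxy hz k (s := s)
        (fun j hj => hs (.inl (.inl j)) (by simpa using hj)) (hs (.inl (.inr ())) (by simp))
        (fun i => hs (.inr i) (by simp)) using 1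
      simp [q, P, Fintype.sum_sum_type, hm0, hite, ← Finset.mul_sum]
      ring
    · simp [T, q, P]
  have hdy :
      deriv (deriv fun s => calogeroKernel m n μ x s z) y
        = (m : ℂ)⁻¹ * (calogeroKernel m n μ x y z * T (.inl (.inr ()))) := by
    refine (deriv_deriv_of_charges hP q (-(m : ℂ)) μ (.inl (.inr ())) _ fun s hs => ?_).trans ?_
    · convert hasLogDerivAt_calogeroKernel_snd hx hz (s := s)
        (fun i => hs (.inl (.inl i)) (by simp)) (fun i => hs (.inr i) (by simp)) using 1
      simp [q, P, Fintype.sum_sum_type, hm0]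
      ring
    · simp [T, q, P]
  have hdz (k : Fin n) :
      deriv (deriv fun s => calogeroKernel m n μ x y (Function.update z k s)) (z k)
        = -(calogeroKernel m n μ x y z * T (.inr k)) := by
    refine (deriv_deriv_of_charges hP q (-(m : ℂ)) μ (.inr k) _ fun s hs => ?_).trans ?_
    · convert hasLogDerivAt_calogeroKernel_thd hx hxy hz k (s := s)
        (fun j hj => hs (.inr j) (by simpa using hj)) (hs (.inl (.inr ())) (by simp))
        (fun i => hs (.inl (.inl i)) (by simp)) using 1
      simp [q, P, Fintype.sum_sum_type, hm0, hite, ← Finset.mul_sum]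
      ring
    · simp [T, q, P]
  have hVxy : ∑ i, 2 * ((m : ℂ) + 1) / (x i - y) ^ 2
      = 2 * ((m : ℂ) + 1) * ∑ i, ((x i - y)⁻¹) ^ 2 := by
    rw [Finset.mul_sum]
    exact Finset.sum_congr rfl fun i _ => by rw [inv_pow]; ring
  have hyx : ∑ i, ((y - x i) ^ 2)⁻¹ = ∑ i, ((x i - y) ^ 2)⁻¹ :=
    Finset.sum_congr rfl fun i _ => by rw [← neg_sub, neg_sq]
  have hT : ∑ i, T (.inl (.inl i)) + T (.inl (.inr ())) + ∑ i, T (.inr i)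
      = μ ^ 2 / m + m * (m + 1) * ∑ i, ∑ j, ((x i - x j)⁻¹) ^ 2
        + 2 * (m + 1) * ∑ i, ((x i - y)⁻¹) ^ 2
        - m * (m + 1) * ∑ i, ∑ j, ((z i - z j)⁻¹) ^ 2 := by
    have h := sum_mul_sq_add_sum_inv_sub hP q (-(m : ℂ)) μ
    simp only [Fintype.sum_sum_type, Finset.univ_unique, Finset.sum_singleton] at h
    simp only [T, Fintype.sum_sum_type, Finset.univ_unique, Finset.sum_singleton]
    refine h.trans ?_
    simp [q, P, hm0, Finset.sum_add_distrib, ← Finset.mul_sum, hyx]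
    field_simp
    ring
  unfold deformedCalogeroMoser calogeroMoser
  simp only [hdx, hdy, hdz, hVxy, mul_assoc (2 : ℂ) (m : ℂ), sum_sum_Ioi_div_sq,
    Finset.sum_neg_distrib, ← Finset.mul_sum]
  rw [mul_inv_cancel_left₀ hm0]
  linear_combination (-calogeroKernel m n μ x y z) * hT

theorem analyticAt_calogeroKernel {E : Type*} [NormedAddCommGroup E] [NormedSpace ℂ E] {p : E}
    {X Z : E → Fin n → ℂ} {Y : E → ℂ} (hX : ∀ i, AnalyticAt ℂ (fun e => X e i) p)
    (hY : AnalyticAt ℂ Y p) (hZ : ∀ i, AnalyticAt ℂ (fun e => Z e i) p)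
    (hx : ∀ i j, i ≠ j → X p i ≠ X p j) (hxy : ∀ i, X p i ≠ Y p)
    (hz : ∀ i j, i ≠ j → Z p i ≠ Z p j) :
    AnalyticAt ℂ (fun e => calogeroKernel m n μ (X e) (Y e) (Z e)) p := by
  unfold calogeroKernel
  refine AnalyticAt.fun_mul (AnalyticAt.fun_div (AnalyticAt.fun_mul (AnalyticAt.fun_pow ?_ m) ?_)
    (AnalyticAt.fun_mul (AnalyticAt.fun_mul (AnalyticAt.fun_pow ?_ m) ?_)
    (AnalyticAt.fun_pow ?_ m)) ?_) (AnalyticAt.cexp' ?_)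
  · exact Finset.analyticAt_fun_prod _ fun i _ => Finset.analyticAt_fun_prod _ fun j _ =>
      (hZ i).fun_sub (hX j)
  · exact Finset.analyticAt_fun_prod _ fun i _ => (hZ i).fun_sub hY
  · exact Finset.analyticAt_fun_prod _ fun i _ => Finset.analyticAt_fun_prod _ fun j _ =>
      (hX i).fun_sub (hX j)
  · exact Finset.analyticAt_fun_prod _ fun i _ => (hX i).fun_sub hY
  · exact Finset.analyticAt_fun_prod _ fun i _ => Finset.analyticAt_fun_prod _ fun j _ =>
      (hZ i).fun_sub (hZ j)
  · exact mul_ne_zero (mul_ne_zero (pow_ne_zero m (prod_prod_Ioi_sub_ne_zero hx))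
      (prod_sub_const_ne_zero hxy)) (pow_ne_zero m (prod_prod_Ioi_sub_ne_zero hz))
  · refine analyticAt_const.fun_mul (AnalyticAt.fun_add (AnalyticAt.fun_sub ?_ ?_) ?_)
    · exact Finset.analyticAt_fun_sum _ fun i _ => hX i
    · exact Finset.analyticAt_fun_sum _ fun i _ => hZ i
    · simpa only [div_eq_mul_inv] using hY.fun_mul analyticAt_const

theorem AnalyticAt.deriv_snd {F : ℂ × ℂ → ℂ} {p : ℂ × ℂ} (hF : AnalyticAt ℂ F p) :
    AnalyticAt ℂ (fun e => deriv (fun s => F (e.1, s)) e.2) p := by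
  have h : AnalyticAt ℂ (fun e => fderiv ℂ F e (0, 1)) p :=
    ((ContinuousLinearMap.apply ℂ ℂ ((0 : ℂ), (1 : ℂ))).analyticAt _).comp hF.fderiv
  refine h.congr ?_
  filter_upwards [hF.eventually_analyticAt] with e he
  have hd : HasDerivAt (fun s => (e.1, s)) ((0 : ℂ), (1 : ℂ)) e.2 :=
    (hasDerivAt_const e.2 e.1).prodMk (hasDerivAt_id e.2)
  exact (HasFDerivAt.comp_hasDerivAt e.2 he.differentiableAt.hasFDerivAt hd).deriv.symm

theorem AnalyticAt.continuousAt_deriv_deriv_snd {F : ℂ × ℂ → ℂ} {r : ℂ → ℂ} {t : ℂ}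
    (hF : AnalyticAt ℂ F (t, r t)) (hr : ContinuousAt r t) :
    ContinuousAt (fun t => deriv (deriv fun s => F (t, s)) (r t)) t :=
  ContinuousAt.comp (f := fun t => (t, r t)) hF.deriv_snd.deriv_snd.continuousAt
    (continuousAt_id.prodMk hr)

theorem analyticAt_update {E : Type*} [NormedAddCommGroup E] [NormedSpace ℂ E] {p : E}
    {X : E → Fin n → ℂ} {f : E → ℂ} (hX : ∀ i, AnalyticAt ℂ (fun e => X e i) p)
    (hf : AnalyticAt ℂ f p) (k i : Fin n) :
    AnalyticAt ℂ (fun e => Function.update (X e) k (f e) i) p := by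
  by_cases hi : i = k
  · subst hi
    simpa using hf
  · simpa [hi] using hX i

theorem continuousAt_calogeroKernel_translate (hx : ∀ i j, i ≠ j → x i ≠ x j)
    (hxy : ∀ i, x i ≠ y) (hz : ∀ i j, i ≠ j → z i ≠ z j) :
    ContinuousAt (fun t => calogeroKernel m n μ x y fun i => z i + t) 0 :=
  (analyticAt_calogeroKernel (X := fun _ => x) (Y := fun _ => y) (Z := fun t i => z i + t)
    (fun _ => analyticAt_const) analyticAt_const
    (fun _ => analyticAt_const.fun_add analyticAt_id) hx hxy (by simpa using hz)).continuousAt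

theorem continuousAt_deformedCalogeroMoser_translate (hx : ∀ i j, i ≠ j → x i ≠ x j)
    (hxy : ∀ i, x i ≠ y) (hz : ∀ i j, i ≠ j → z i ≠ z j) :
    ContinuousAt (fun t => deformedCalogeroMoser m
      (fun X Y => calogeroKernel m n μ X Y fun i => z i + t) x y) 0 := by
  have hz0 : ∀ i j, i ≠ j → z i + 0 ≠ z j + 0 := by simpa using hz
  unfold deformedCalogeroMoser
  refine ContinuousAt.add (ContinuousAt.sub (ContinuousAt.neg ?_) ?_) ?_
  · refine tendsto_finsetSum _ fun k _ => ?_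
    refine AnalyticAt.continuousAt_deriv_deriv_snd (r := fun _ => x k)
      (F := fun e => calogeroKernel m n μ (Function.update x k e.2) y fun i => z i + e.1)
      (analyticAt_calogeroKernel (Y := fun _ => y)
        (analyticAt_update (X := fun _ => x) (fun _ => analyticAt_const) analyticAt_snd k)
        analyticAt_const (fun _ => analyticAt_const.fun_add analyticAt_fst) ?_ ?_ hz0)
      continuousAt_const
    · simpa using hx
    · simpa using hxy
  · exact continuousAt_const.mul (AnalyticAt.continuousAt_deriv_deriv_snd (r := fun _ => y)
      (F := fun e => calogeroKernel m n μ x e.2 fun i => z i + e.1)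
      (analyticAt_calogeroKernel (X := fun _ => x) (fun _ => analyticAt_const) analyticAt_snd
        (fun _ => analyticAt_const.fun_add analyticAt_fst) hx hxy hz0) continuousAt_const)
  · exact continuousAt_const.mul (continuousAt_calogeroKernel_translate hx hxy hz)

theorem continuousAt_calogeroMoser_translate (hx : ∀ i j, i ≠ j → x i ≠ x j)
    (hxy : ∀ i, x i ≠ y) (hz : ∀ i j, i ≠ j → z i ≠ z j) :
    ContinuousAt (fun t => calogeroMoser m (fun Z => calogeroKernel m n μ x y Z)
      fun i => z i + t) 0 := by
  have hz0 : ∀ i j, i ≠ j → z i + 0 ≠ z j + 0 := by simpa using hz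
  unfold calogeroMoser
  refine ContinuousAt.add (ContinuousAt.neg ?_) (ContinuousAt.mul ?_ ?_)
  · refine tendsto_finsetSum _ fun k _ => ?_
    refine AnalyticAt.continuousAt_deriv_deriv_snd (r := fun t => z k + t)
      (F := fun e => calogeroKernel m n μ x y (Function.update (fun i => z i + e.1) k e.2))
      (analyticAt_calogeroKernel (X := fun _ => x) (Y := fun _ => y)
        (fun _ => analyticAt_const) analyticAt_const
        (analyticAt_update (fun _ => analyticAt_const.fun_add analyticAt_fst) analyticAt_snd k)
        hx hxy ?_) (by fun_prop)
    simpa using hz0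
  · simp only [add_sub_add_right_eq_sub]
    exact continuousAt_const
  · exact continuousAt_calogeroKernel_translate hx hxy hz

theorem deformedCalogeroMoser_calogeroKernel (hm : 0 < m)
    (hx : ∀ i j, i ≠ j → x i ≠ x j) (hxy : ∀ i, x i ≠ y) (hz : ∀ i j, i ≠ j → z i ≠ z j) :
    deformedCalogeroMoser m (fun X Y => calogeroKernel m n μ X Y z) x y
      = calogeroMoser m (fun Z => calogeroKernel m n μ x y Z) z
        - μ ^ 2 / (m : ℂ) * calogeroKernel m n μ x y z := by
  have hL := continuousAt_deformedCalogeroMoser_translate (m := m) (μ := μ) hx hxy hz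
  have hR := (continuousAt_calogeroMoser_translate (m := m) (μ := μ) hx hxy hz).sub
    (continuousAt_const.mul
      (continuousAt_calogeroKernel_translate hx hxy hz) : ContinuousAt (fun t => μ ^ 2 / (m : ℂ) *
        calogeroKernel m n μ x y fun i => z i + t) 0)
  have hne (c d : ℂ) : ∀ᶠ t in nhdsWithin (0 : ℂ) {0}ᶜ, c + t ≠ d := by
    by_cases hcd : c = d
    · filter_upwards [self_mem_nhdsWithin] with t ht
      simpa [hcd] using ht
    · refine nhdsWithin_le_nhds (ContinuousAt.eventually_ne (g := fun t => c + t) ?_ ?_)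
      · fun_prop
      · simpa using hcd
  have hev : ∀ᶠ t in nhdsWithin (0 : ℂ) {0}ᶜ,
      deformedCalogeroMoser m (fun X Y => calogeroKernel m n μ X Y fun i => z i + t) x y
        = calogeroMoser m (fun Z => calogeroKernel m n μ x y Z) (fun i => z i + t)
          - μ ^ 2 / (m : ℂ) * calogeroKernel m n μ x y fun i => z i + t := by
    filter_upwards [Filter.eventually_all.2 fun i => Filter.eventually_all.2 fun j =>
      hne (z i) (x j), Filter.eventually_all.2 fun i => hne (z i) y] with t htx hty
    exact deformedCalogeroMoser_calogeroKernel_of_generic hm hx hxy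
      (fun i j hij => by simpa using hz i j hij) htx hty
  have h := tendsto_nhds_unique_of_eventuallyEq (hL.tendsto.mono_left nhdsWithin_le_nhds)
    (hR.tendsto.mono_left nhdsWithin_le_nhds) hev
  simpa using h

end KernelIdentity

/-- The kernel identity specialised to `(k,l) = (n,1)`, `(p,q) = (n,0)`:
with `K(x,y;z) = A(z,x)^m A(z,y) / (A(x)^m A(x,y) A(z)^m) · e^{μ(x̄ - z̄ + y/m)}`
one has `L_m^{(n,1)}(x,y) K = L_m^{(n)}(z) K - (μ²/m) K`, where `L_m^{(n,1)}`
is the deformed rational Calogero–Moser operator. -/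
theorem deformed_kernel_n_one (m : ℕ) (hm : 0 < m) (n : ℕ) (μ : ℂ)
    (lam : Fin n → ℂ) (hlam : ∀ i, lam i ≠ μ)
    (x : Fin n → ℂ) (y : ℂ) (z : Fin n → ℂ)
    (hx : ∀ i j, i ≠ j → x i ≠ x j) (hxy : ∀ i, x i ≠ y)
    (hz : ∀ i j, i ≠ j → z i ≠ z j)
    (K : (Fin n → ℂ) → ℂ → (Fin n → ℂ) → ℂ)
    (hK : K = fun X Y Z =>
      (∏ i, ∏ j, (Z i - X j)) ^ m * (∏ i, (Z i - Y))
        / ((∏ i, ∏ j ∈ Finset.Ioi i, (X i - X j)) ^ m * (∏ i, (X i - Y))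
            * (∏ i, ∏ j ∈ Finset.Ioi i, (Z i - Z j)) ^ m)
        * Complex.exp (μ * (∑ i, X i - ∑ i, Z i + Y / (m : ℂ)))) :
    -(∑ i, deriv (deriv (fun s => K (Function.update x i s) y z)) (x i))
      - (m : ℂ) * deriv (deriv (fun s => K x s z)) y
      + ((∑ i, ∑ j ∈ Finset.Ioi i, 2 * (m : ℂ) * ((m : ℂ) + 1) / (x i - x j) ^ 2)
          + (∑ i, 2 * ((m : ℂ) + 1) / (x i - y) ^ 2)) * K x y z
    = -(∑ i, deriv (deriv (fun s => K x y (Function.update z i s))) (z i))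
        + (∑ i, ∑ j ∈ Finset.Ioi i, 2 * (m : ℂ) * ((m : ℂ) + 1) / (z i - z j) ^ 2) * K x y z
        - (μ ^ 2 / (m : ℂ)) * K x y z := by
  subst hK
  exact deformedCalogeroMoser_calogeroKernel hm hx hxy hz
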